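/- arXiv:math-ph/0501015 — 8 statements merged into one kernel-verified Lean document; each statement's English description precedes it below -/
import Mathlib

section
/- With the notation of the context, for every r > 0 the following identity holds: (m₁(1−r₁²)²(1+r₂²)² + m₂(1+r₁²)²(1−r₂²)²) / (4R²m₁m₂(r₁−r₂)²(1+r₁r₂)²) = (1/R²)·( (1+r²)²/(8mr²) + ((1−r⁴)/(8mr²))·cos ζ + ((1+r²)/(4m₁m₂r))·(m₁−m₂)·sin ζ ). -/
/-- A weighted sum of `cos² (2x)` and `cos² (2y)`, expressed through the sum and the difference
of the angles. -/
theorem weighted_cos_sq_two_mul (m₁ m₂ x y : ℝ) :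
    2 * (m₁ * Real.cos (2 * x) ^ 2 + m₂ * Real.cos (2 * y) ^ 2)
      = (m₁ + m₂) * (1 + Real.cos (2 * (x + y)) * Real.cos (2 * (y - x)))
        + (m₁ - m₂) * Real.sin (2 * (x + y)) * Real.sin (2 * (y - x)) := by
  rw [mul_add 2 x, mul_sub, Real.cos_add, Real.cos_sub, Real.sin_add, Real.sin_sub]
  have hX := Real.sin_sq_add_cos_sq (2 * x)
  have hY := Real.sin_sq_add_cos_sq (2 * y)
  linear_combination
    (m₁ + m₂) * (Real.sin (2 * y) ^ 2 * hX + (1 - Real.cos (2 * x) ^ 2) * hY)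
      - (m₁ - m₂) * (Real.cos (2 * x) ^ 2 * hY - Real.cos (2 * y) ^ 2 * hX)

theorem one_add_tan_sq_eq {x : ℝ} (hx : Real.cos x ≠ 0) :
    1 + Real.tan x ^ 2 = 1 / Real.cos x ^ 2 := by
  rw [one_div, ← Real.inv_one_add_tan_sq hx, inv_inv]

theorem one_sub_tan_sq_eq {x : ℝ} (hx : Real.cos x ≠ 0) :
    1 - Real.tan x ^ 2 = Real.cos (2 * x) / Real.cos x ^ 2 := by
  rw [Real.tan_eq_sin_div_cos, Real.cos_two_mul']
  field_simp

theorem tan_add_tan_eq {x y : ℝ} (hx : Real.cos x ≠ 0) (hy : Real.cos y ≠ 0) :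
    Real.tan x + Real.tan y = Real.sin (x + y) / (Real.cos x * Real.cos y) := by
  rw [Real.tan_eq_sin_div_cos, Real.tan_eq_sin_div_cos, Real.sin_add]
  field_simp

theorem one_sub_tan_mul_tan_eq {x y : ℝ} (hx : Real.cos x ≠ 0) (hy : Real.cos y ≠ 0) :
    1 - Real.tan x * Real.tan y = Real.cos (x + y) / (Real.cos x * Real.cos y) := by
  rw [Real.tan_eq_sin_div_cos, Real.tan_eq_sin_div_cos, Real.cos_add]
  field_simp

/-- The identity in terms of two angles `x`, `y` with `r = tan (x + y)`. -/
theorem As_identity_angles {m₁ m₂ R x y : ℝ} (hm₁ : m₁ ≠ 0) (hm₂ : m₂ ≠ 0) (hR : R ≠ 0)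
    (hx : Real.cos x ≠ 0) (hy : Real.cos y ≠ 0)
    (hs : Real.sin (x + y) ≠ 0) (hc : Real.cos (x + y) ≠ 0) :
    (m₁ * (1 - Real.tan x ^ 2) ^ 2 * (1 + Real.tan y ^ 2) ^ 2
        + m₂ * (1 + Real.tan x ^ 2) ^ 2 * (1 - Real.tan y ^ 2) ^ 2)
        / (4 * R ^ 2 * m₁ * m₂ * (Real.tan x + Real.tan y) ^ 2
          * (1 - Real.tan x * Real.tan y) ^ 2)
      = (1 / R ^ 2) * ((1 + Real.tan (x + y) ^ 2) ^ 2
            / (8 * (m₁ * m₂ / (m₁ + m₂)) * Real.tan (x + y) ^ 2)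
          + ((1 - Real.tan (x + y) ^ 4) / (8 * (m₁ * m₂ / (m₁ + m₂)) * Real.tan (x + y) ^ 2))
            * Real.cos (2 * (y - x))
          + ((1 + Real.tan (x + y) ^ 2) / (4 * m₁ * m₂ * Real.tan (x + y))) * (m₁ - m₂)
            * Real.sin (2 * (y - x))) := by
  have key := weighted_cos_sq_two_mul m₁ m₂ x y
  have h4 : 1 - Real.tan (x + y) ^ 4
      = (1 - Real.tan (x + y) ^ 2) * (1 + Real.tan (x + y) ^ 2) := by ring
  rw [h4, one_add_tan_sq_eq hx, one_add_tan_sq_eq hy, one_add_tan_sq_eq hc, one_sub_tan_sq_eq hx,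
    one_sub_tan_sq_eq hy, one_sub_tan_sq_eq hc, tan_add_tan_eq hx hy,
    one_sub_tan_mul_tan_eq hx hy, Real.tan_eq_sin_div_cos (x + y)]
  rw [Real.sin_two_mul (x + y)] at key
  generalize Real.sin (x + y) = s at *
  generalize Real.cos (x + y) = c at *
  generalize Real.cos (2 * (x + y)) = C at *
  field_simp
  linear_combination 4 * key

/- STATEMENT 2: Expression of the coefficient A_s through the coordinate r. -/

theorem As_identity (m₁ m₂ R : ℝ) (hm₁ : 0 < m₁) (hm₂ : 0 < m₂) (hR : 0 < R)
    (r : ℝ) (hr : 0 < r) :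
    let m := m₁ * m₂ / (m₁ + m₂)
    let r₁ := Real.tan ((m₂ / (m₁ + m₂)) * Real.arctan r)
    let r₂ := -Real.tan ((m₁ / (m₁ + m₂)) * Real.arctan r)
    let ζ := 2 * ((m₁ - m₂) / (m₁ + m₂)) * Real.arctan r
    (m₁ * (1 - r₁ ^ 2) ^ 2 * (1 + r₂ ^ 2) ^ 2 + m₂ * (1 + r₁ ^ 2) ^ 2 * (1 - r₂ ^ 2) ^ 2)
        / (4 * R ^ 2 * m₁ * m₂ * (r₁ - r₂) ^ 2 * (1 + r₁ * r₂) ^ 2)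
      = (1 / R ^ 2) * ((1 + r ^ 2) ^ 2 / (8 * m * r ^ 2)
          + ((1 - r ^ 4) / (8 * m * r ^ 2)) * Real.cos ζ
          + ((1 + r ^ 2) / (4 * m₁ * m₂ * r)) * (m₁ - m₂) * Real.sin ζ) := by
  intro m r₁ r₂ ζ
  have hm : 0 < m₁ + m₂ := add_pos hm₁ hm₂
  have hθ : 0 < Real.arctan r := Real.arctan_pos.2 hr
  have hθ' : Real.arctan r < Real.pi / 2 := Real.arctan_lt_pi_div_two r
  have hsum : m₂ / (m₁ + m₂) * Real.arctan r + m₁ / (m₁ + m₂) * Real.arctan r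
      = Real.arctan r := by field_simp; ring
  have hζ : ζ = 2 * (m₁ / (m₁ + m₂) * Real.arctan r - m₂ / (m₁ + m₂) * Real.arctan r) := by
    simp only [ζ]; ring
  have hx : 0 < m₂ / (m₁ + m₂) * Real.arctan r := by positivity
  have hy : 0 < m₁ / (m₁ + m₂) * Real.arctan r := by positivity
  have h := As_identity_angles hm₁.ne' hm₂.ne' hR.ne'
    (Real.cos_pos_of_mem_Ioo ⟨by linarith, by linarith⟩ :
      0 < Real.cos (m₂ / (m₁ + m₂) * Real.arctan r)).ne'
    (Real.cos_pos_of_mem_Ioo ⟨by linarith, by linarith⟩ :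
      0 < Real.cos (m₁ / (m₁ + m₂) * Real.arctan r)).ne'
    (by rw [hsum]; exact (Real.sin_pos_of_pos_of_lt_pi hθ (by linarith)).ne')
    (by rw [hsum]; exact (Real.cos_arctan_pos r).ne')
  rw [hsum, Real.tan_arctan, ← hζ] at h
  simpa only [m, r₁, r₂, neg_sq, sub_neg_eq_add, mul_neg, ← sub_eq_add_neg] using h
end

section
/- With the notation of the context, for every r > 0 the following identity holds: (m₁r₁(1−r₁²)(1+r₂²)² + m₂r₂(1−r₂²)(1+r₁²)²) / (2R²m₁m₂(r₁−r₂)²(1+r₁r₂)²) = −(1/(4R²))·( ((m₂−m₁)/(m₁m₂r))·(1+r²)·cos ζ + ((1−r⁴)/(2mr²))·sin ζ ). -/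
/-- The numerator of the left-hand side in terms of half the angles, with `r₁ = tan a` and
`r₂ = -tan b`. -/
theorem tan_numerator_eq (m₁ m₂ a b : ℝ) (ha : Real.cos a ≠ 0) (hb : Real.cos b ≠ 0) :
    m₁ * Real.tan a * (1 - Real.tan a ^ 2) * (1 + (-Real.tan b) ^ 2) ^ 2
        + m₂ * -Real.tan b * (1 - (-Real.tan b) ^ 2) * (1 + Real.tan a ^ 2) ^ 2
      = (m₁ * Real.sin (4 * a) - m₂ * Real.sin (4 * b))
        / (4 * (Real.cos a * Real.cos b) ^ 4) := by
  have one_add (x : ℝ) (hx : Real.cos x ≠ 0) : 1 + Real.tan x ^ 2 = 1 / Real.cos x ^ 2 := by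
    rw [Real.tan_eq_sin_div_cos]
    field_simp
    linarith [Real.sin_sq_add_cos_sq x]
  have tan_mul (x : ℝ) (hx : Real.cos x ≠ 0) :
      Real.tan x * (1 - Real.tan x ^ 2) = Real.sin (4 * x) / (4 * Real.cos x ^ 4) := by
    rw [show 4 * x = 2 * (2 * x) by ring, Real.sin_two_mul (2 * x), Real.sin_two_mul,
      Real.cos_two_mul', Real.tan_eq_sin_div_cos]
    field_simp
    ring
  rw [neg_sq, one_add a ha, one_add b hb, mul_assoc m₁, tan_mul a ha,
    show m₂ * -Real.tan b * (1 - Real.tan b ^ 2)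
      = -(m₂ * (Real.tan b * (1 - Real.tan b ^ 2))) by ring, tan_mul b hb]
  field_simp
  ring

theorem sin_four_mul_combination (m₁ m₂ a b : ℝ) :
    m₁ * Real.sin (4 * a) - m₂ * Real.sin (4 * b)
      = (m₁ - m₂) * Real.sin (2 * (a + b)) * Real.cos (2 * (b - a))
        - (m₁ + m₂) * Real.cos (2 * (a + b)) * Real.sin (2 * (b - a)) := by
  rw [show 4 * a = 2 * (a + b) - 2 * (b - a) by ring,
    show 4 * b = 2 * (a + b) + 2 * (b - a) by ring, Real.sin_sub, Real.sin_add]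
  ring

theorem tan_identity (m₁ m₂ R a b : ℝ) (hm₁ : 0 < m₁) (hm₂ : 0 < m₂) (hR : 0 < R)
    (ha : Real.cos a ≠ 0) (hb : Real.cos b ≠ 0) (hs : Real.sin (a + b) ≠ 0)
    (hc : Real.cos (a + b) ≠ 0) :
    (m₁ * Real.tan a * (1 - Real.tan a ^ 2) * (1 + (-Real.tan b) ^ 2) ^ 2
        + m₂ * -Real.tan b * (1 - (-Real.tan b) ^ 2) * (1 + Real.tan a ^ 2) ^ 2)
        / (2 * R ^ 2 * m₁ * m₂ * (Real.tan a - -Real.tan b) ^ 2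
          * (1 + Real.tan a * -Real.tan b) ^ 2)
      = -(1 / (4 * R ^ 2)) * (((m₂ - m₁) / (m₁ * m₂ * Real.tan (a + b)))
          * (1 + Real.tan (a + b) ^ 2) * Real.cos (2 * (b - a))
          + ((1 - Real.tan (a + b) ^ 4) / (2 * (m₁ * m₂ / (m₁ + m₂)) * Real.tan (a + b) ^ 2))
            * Real.sin (2 * (b - a))) := by
  have hM : m₁ + m₂ ≠ 0 := by positivity
  have sub_eq : Real.tan a - -Real.tan b
      = Real.sin (a + b) / (Real.cos a * Real.cos b) := by
    rw [Real.sin_add, Real.tan_eq_sin_div_cos, Real.tan_eq_sin_div_cos]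
    field_simp
    ring
  have add_eq : 1 + Real.tan a * -Real.tan b
      = Real.cos (a + b) / (Real.cos a * Real.cos b) := by
    rw [Real.cos_add, Real.tan_eq_sin_div_cos, Real.tan_eq_sin_div_cos]
    field_simp
    ring
  have one_add_sq : 1 + Real.tan (a + b) ^ 2 = 1 / Real.cos (a + b) ^ 2 := by
    rw [Real.tan_eq_sin_div_cos]
    field_simp
    linarith [Real.sin_sq_add_cos_sq (a + b)]
  have one_sub_pow : 1 - Real.tan (a + b) ^ 4
      = Real.cos (2 * (a + b)) / Real.cos (a + b) ^ 4 := by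
    rw [show 1 - Real.tan (a + b) ^ 4
      = (1 + Real.tan (a + b) ^ 2) * (1 - Real.tan (a + b) ^ 2) by ring, one_add_sq,
      Real.tan_eq_sin_div_cos, Real.cos_two_mul']
    field_simp
  rw [tan_numerator_eq m₁ m₂ a b ha hb, sin_four_mul_combination, sub_eq, add_eq, one_add_sq,
    one_sub_pow, Real.tan_eq_sin_div_cos (a + b), Real.sin_two_mul (a + b)]
  generalize Real.sin (a + b) = s at *
  generalize Real.cos (a + b) = c at *
  field_simp
  ring


/- STATEMENT 3: Expression of the coefficient B_s through the coordinate r. -/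

theorem Bs_identity (m₁ m₂ R : ℝ) (hm₁ : 0 < m₁) (hm₂ : 0 < m₂) (hR : 0 < R)
    (r : ℝ) (hr : 0 < r) :
    let m := m₁ * m₂ / (m₁ + m₂)
    let r₁ := Real.tan ((m₂ / (m₁ + m₂)) * Real.arctan r)
    let r₂ := -Real.tan ((m₁ / (m₁ + m₂)) * Real.arctan r)
    let ζ := 2 * ((m₁ - m₂) / (m₁ + m₂)) * Real.arctan r
    (m₁ * r₁ * (1 - r₁ ^ 2) * (1 + r₂ ^ 2) ^ 2 + m₂ * r₂ * (1 - r₂ ^ 2) * (1 + r₁ ^ 2) ^ 2)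
        / (2 * R ^ 2 * m₁ * m₂ * (r₁ - r₂) ^ 2 * (1 + r₁ * r₂) ^ 2)
      = -(1 / (4 * R ^ 2)) * (((m₂ - m₁) / (m₁ * m₂ * r)) * (1 + r ^ 2) * Real.cos ζ
          + ((1 - r ^ 4) / (2 * m * r ^ 2)) * Real.sin ζ) := by
  intro m r₁ r₂ ζ
  have hM : 0 < m₁ + m₂ := by positivity
  have hθ : 0 < Real.arctan r := Real.arctan_pos.mpr hr
  have hθ' := Real.arctan_lt_pi_div_two r
  have sum_eq : m₂ / (m₁ + m₂) * Real.arctan r + m₁ / (m₁ + m₂) * Real.arctan r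
      = Real.arctan r := by
    field_simp
    ring
  have ha : 0 < m₂ / (m₁ + m₂) * Real.arctan r := by positivity
  have hb : 0 < m₁ / (m₁ + m₂) * Real.arctan r := by positivity
  have hζ : ζ = 2 * (m₁ / (m₁ + m₂) * Real.arctan r - m₂ / (m₁ + m₂) * Real.arctan r) := by
    simp only [ζ]
    ring
  have key := tan_identity m₁ m₂ R (m₂ / (m₁ + m₂) * Real.arctan r)
    (m₁ / (m₁ + m₂) * Real.arctan r) hm₁ hm₂ hR
    (Real.cos_pos_of_mem_Ioo ⟨by linarith, by linarith⟩).ne'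
    (Real.cos_pos_of_mem_Ioo ⟨by linarith, by linarith⟩).ne'
    (by rw [sum_eq]; exact (Real.sin_pos_of_pos_of_lt_pi hθ (by linarith)).ne')
    (by rw [sum_eq]; exact (Real.cos_arctan_pos r).ne')
  rw [sum_eq, Real.tan_arctan, ← hζ] at key
  exact key
end

section
/- With the notation of the context, for every r > 0 the following identity holds: (m₁r₁²(1+r₂²)² + m₂r₂²(1+r₁²)²) / (R²m₁m₂(r₁−r₂)²(1+r₁r₂)²) = (1/R²)·( (1+r²)²/(8mr²) − ((1−r⁴)/(8mr²))·cos ζ − ((1+r²)/(4m₁m₂r))·(m₁−m₂)·sin ζ ). -/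
theorem Real.cos_two_mul_eq_tan {x : ℝ} (hx : Real.cos x ≠ 0) :
    Real.cos (2 * x) = (1 - Real.tan x ^ 2) / (1 + Real.tan x ^ 2) := by
  have h := Real.sin_sq_add_cos_sq x
  rw [Real.cos_two_mul', Real.tan_eq_sin_div_cos]
  field_simp
  rw [add_comm (Real.cos x ^ 2), h]
  ring

theorem Real.sin_two_mul_eq_tan {x : ℝ} (hx : Real.cos x ≠ 0) :
    Real.sin (2 * x) = 2 * Real.tan x / (1 + Real.tan x ^ 2) := by
  have h := Real.sin_sq_add_cos_sq x
  rw [Real.sin_two_mul, Real.tan_eq_sin_div_cos]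
  field_simp
  rw [add_comm (Real.cos x ^ 2), h]
  ring

theorem Cs_identity (m₁ m₂ R : ℝ) (hm₁ : 0 < m₁) (hm₂ : 0 < m₂) (hR : 0 < R)
    (r : ℝ) (hr : 0 < r) :
    let m := m₁ * m₂ / (m₁ + m₂)
    let r₁ := Real.tan ((m₂ / (m₁ + m₂)) * Real.arctan r)
    let r₂ := -Real.tan ((m₁ / (m₁ + m₂)) * Real.arctan r)
    let ζ := 2 * ((m₁ - m₂) / (m₁ + m₂)) * Real.arctan r
    (m₁ * r₁ ^ 2 * (1 + r₂ ^ 2) ^ 2 + m₂ * r₂ ^ 2 * (1 + r₁ ^ 2) ^ 2)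
        / (R ^ 2 * m₁ * m₂ * (r₁ - r₂) ^ 2 * (1 + r₁ * r₂) ^ 2)
      = (1 / R ^ 2) * ((1 + r ^ 2) ^ 2 / (8 * m * r ^ 2)
          - ((1 - r ^ 4) / (8 * m * r ^ 2)) * Real.cos ζ
          - ((1 + r ^ 2) / (4 * m₁ * m₂ * r)) * (m₁ - m₂) * Real.sin ζ) := by
  intro m r₁ r₂ ζ
  have hM : 0 < m₁ + m₂ := add_pos hm₁ hm₂
  set a := m₂ / (m₁ + m₂) * Real.arctan r with ha
  set b := m₁ / (m₁ + m₂) * Real.arctan r with hb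
  have hab : a + b = Real.arctan r := by
    rw [ha, hb]; field_simp; ring
  have hζ : ζ = 2 * b - 2 * a := by
    simp only [ζ, ha, hb]; field_simp
  have hθ : 0 < Real.arctan r := Real.arctan_pos.mpr hr
  have hθ' := Real.arctan_lt_pi_div_two r
  have ha0 : 0 < a := by positivity
  have hb0 : 0 < b := by positivity
  have hca : 0 < Real.cos a := Real.cos_pos_of_mem_Ioo ⟨by linarith, by linarith⟩
  have hcb : 0 < Real.cos b := Real.cos_pos_of_mem_Ioo ⟨by linarith, by linarith⟩
  have hcab : 0 < Real.cos (a + b) := hab ▸ Real.cos_arctan_pos r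
  have hx : 0 < Real.tan a := Real.tan_pos_of_pos_of_lt_pi_div_two ha0 (by linarith)
  have hy : 0 < Real.tan b := Real.tan_pos_of_pos_of_lt_pi_div_two hb0 (by linarith)
  have hxy : 1 - Real.tan a * Real.tan b ≠ 0 := by
    have : 1 - Real.tan a * Real.tan b = Real.cos (a + b) / (Real.cos a * Real.cos b) := by
      rw [Real.cos_add, Real.tan_eq_sin_div_cos, Real.tan_eq_sin_div_cos]
      field_simp
    rw [this]
    positivity
  have hr_eq : r = (Real.tan a + Real.tan b) / (1 - Real.tan a * Real.tan b) := by
    have : r = Real.tan (a + b) := by rw [hab, Real.tan_arctan]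
    rw [this, Real.tan_eq_sin_div_cos, Real.sin_add, Real.cos_add, Real.tan_eq_sin_div_cos,
      Real.tan_eq_sin_div_cos]
    rw [Real.cos_add] at hcab
    have h1 : 1 - Real.sin a / Real.cos a * (Real.sin b / Real.cos b) ≠ 0 := by
      rwa [← Real.tan_eq_sin_div_cos, ← Real.tan_eq_sin_div_cos]
    rw [div_eq_div_iff hcab.ne' h1]
    field_simp
  rw [hζ, Real.cos_sub, Real.sin_sub, Real.cos_two_mul_eq_tan hca.ne',
    Real.cos_two_mul_eq_tan hcb.ne', Real.sin_two_mul_eq_tan hca.ne',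
    Real.sin_two_mul_eq_tan hcb.ne']
  simp only [m, r₁, r₂, ← ha, ← hb]
  clear_value a b
  generalize Real.tan a = x at *
  generalize Real.tan b = y at *
  clear hab hθ hθ' ha hb hζ hca hcb hcab
  subst hr_eq
  have hs : x + y ≠ 0 := by positivity
  rw [show x - -y = x + y by ring, show 1 + x * -y = 1 - x * y by ring]
  field_simp
  ring
end

section
/- With the notation of the context, let ℓ₁ = 1/2 and let ℓ₂ be a half-odd-integer (ℓ₂ ∈ {1/2, 3/2, 5/2, …}). Then the vector v := χ_{1/2} + χ_{−1/2} satisfies D₀²v = −v, D₁v = −(ℓ₂² + 2ℓ₂ + 3/4)·v, D₂v = −(ℓ₂² − 1/4)·v, and D₃v = −i(ℓ₂ + 1/2)·(χ_{1/2} − χ_{−1/2}). -/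
open TensorProduct

noncomputable section

namespace Spin

/-- The spin-`L/2` module data: `ψ m` represents the basis vector `ψ_{m/2}`
(indices are doubled so that they are integers; `ψ m = 0` for `|m| > L`), and
`T₀, Tp, Tm` act by `T₀ψ_n = n ψ_n`, `Tpψ_n = -√((ℓ-n)(ℓ+n+1)) ψ_{n+1}`,
`Tmψ_n = -√((ℓ+n)(ℓ-n+1)) ψ_{n-1}`, where `ℓ = L/2` and `n = m/2`. -/
def IsSpinModule {U : Type} [AddCommGroup U] [Module ℂ U]
    (L : ℕ) (ψ : ℤ → U) (T₀ Tp Tm : U →ₗ[ℂ] U) : Prop :=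
  (∀ m : ℤ, (L : ℤ) < |m| → ψ m = 0) ∧
  (∀ m : ℤ, T₀ (ψ m) = ((m : ℂ) / 2) • ψ m) ∧
  (∀ m : ℤ, Tp (ψ m) =
    ((-Real.sqrt ((((L : ℝ) - (m : ℝ)) / 2) * (((L : ℝ) + (m : ℝ)) / 2 + 1)) : ℝ) : ℂ) •
      ψ (m + 2)) ∧
  (∀ m : ℤ, Tm (ψ m) =
    ((-Real.sqrt ((((L : ℝ) + (m : ℝ)) / 2) * (((L : ℝ) - (m : ℝ)) / 2 + 1)) : ℝ) : ℂ) •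
      ψ (m - 2))

variable {U V : Type} [AddCommGroup U] [Module ℂ U] [AddCommGroup V] [Module ℂ V]

/-- Action of an operator on the first tensor factor. -/
def opT (T : U →ₗ[ℂ] U) : (U ⊗[ℂ] V) →ₗ[ℂ] (U ⊗[ℂ] V) := LinearMap.rTensor V T

/-- Action of an operator on the second tensor factor. -/
def opW (W : V →ₗ[ℂ] V) : (U ⊗[ℂ] V) →ₗ[ℂ] (U ⊗[ℂ] V) := LinearMap.lTensor U W

/-- `D₀ = i(T₀ - W₀)`. -/
def Dzero (T₀ : U →ₗ[ℂ] U) (W₀ : V →ₗ[ℂ] V) : (U ⊗[ℂ] V) →ₗ[ℂ] (U ⊗[ℂ] V) :=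
  Complex.I • (opT T₀ - opW W₀)

/-- `TpTm + TmTp + WpWm + WmWp`. -/
def Dquad (Tp Tm : U →ₗ[ℂ] U) (Wp Wm : V →ₗ[ℂ] V) : (U ⊗[ℂ] V) →ₗ[ℂ] (U ⊗[ℂ] V) :=
  opT Tp ∘ₗ opT Tm + opT Tm ∘ₗ opT Tp + opW Wp ∘ₗ opW Wm + opW Wm ∘ₗ opW Wp

/-- `TpWm + TmWp`. -/
def Across (Tp Tm : U →ₗ[ℂ] U) (Wp Wm : V →ₗ[ℂ] V) : (U ⊗[ℂ] V) →ₗ[ℂ] (U ⊗[ℂ] V) :=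
  opT Tp ∘ₗ opW Wm + opT Tm ∘ₗ opW Wp

/-- `D₁ = -(1/2)(TpTm + TmTp + WpWm + WmWp) - TpWm - TmWp`. -/
def Done (Tp Tm : U →ₗ[ℂ] U) (Wp Wm : V →ₗ[ℂ] V) : (U ⊗[ℂ] V) →ₗ[ℂ] (U ⊗[ℂ] V) :=
  (-(1 / 2 : ℂ)) • Dquad Tp Tm Wp Wm - Across Tp Tm Wp Wm

/-- `D₂ = -(1/2)(TpTm + TmTp + WpWm + WmWp) + TpWm + TmWp`. -/
def Dtwo (Tp Tm : U →ₗ[ℂ] U) (Wp Wm : V →ₗ[ℂ] V) : (U ⊗[ℂ] V) →ₗ[ℂ] (U ⊗[ℂ] V) :=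
  (-(1 / 2 : ℂ)) • Dquad Tp Tm Wp Wm + Across Tp Tm Wp Wm

/-- `D₃ = i(TmWp - TpWm)`. -/
def Dthree (Tp Tm : U →ₗ[ℂ] U) (Wp Wm : V →ₗ[ℂ] V) : (U ⊗[ℂ] V) →ₗ[ℂ] (U ⊗[ℂ] V) :=
  Complex.I • (opT Tm ∘ₗ opW Wp - opT Tp ∘ₗ opW Wm)

end Spin

namespace Spin

section SpinModule

variable {U : Type} [AddCommGroup U] [Module ℂ U] {L : ℕ} {ψ : ℤ → U} {T₀ Tp Tm : U →ₗ[ℂ] U}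

theorem IsSpinModule.raise_lower (h : IsSpinModule L ψ T₀ Tp Tm) {m : ℤ} (hm : |m| ≤ L) :
    Tp (Tm (ψ m)) = (((L + m) / 2) * ((L - m) / 2 + 1) : ℂ) • ψ m := by
  obtain ⟨-, -, hp, hm'⟩ := h
  obtain ⟨h₁, h₂⟩ := abs_le.mp hm
  have h₁' : -(L : ℝ) ≤ m := by exact_mod_cast h₁
  have h₂' : (m : ℝ) ≤ L := by exact_mod_cast h₂
  have hnn : 0 ≤ (((L : ℝ) + m) / 2) * (((L : ℝ) - m) / 2 + 1) :=
    mul_nonneg (by linarith) (by linarith)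
  have hr : (((L : ℝ) - (m - 2)) / 2) * (((L : ℝ) + (m - 2)) / 2 + 1) =
      (((L : ℝ) + m) / 2) * (((L : ℝ) - m) / 2 + 1) := by ring
  rw [hm', map_smul, hp, sub_add_cancel, smul_smul]
  push_cast
  rw [hr, neg_mul_neg, ← Complex.ofReal_mul, Real.mul_self_sqrt hnn]
  push_cast
  rfl

theorem IsSpinModule.lower_raise (h : IsSpinModule L ψ T₀ Tp Tm) {m : ℤ} (hm : |m| ≤ L) :
    Tm (Tp (ψ m)) = (((L - m) / 2) * ((L + m) / 2 + 1) : ℂ) • ψ m := by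
  obtain ⟨-, -, hp, hm'⟩ := h
  obtain ⟨h₁, h₂⟩ := abs_le.mp hm
  have h₁' : -(L : ℝ) ≤ m := by exact_mod_cast h₁
  have h₂' : (m : ℝ) ≤ L := by exact_mod_cast h₂
  have hnn : 0 ≤ (((L : ℝ) - m) / 2) * (((L : ℝ) + m) / 2 + 1) :=
    mul_nonneg (by linarith) (by linarith)
  have hr : (((L : ℝ) + (m + 2)) / 2) * (((L : ℝ) - (m + 2)) / 2 + 1) =
      (((L : ℝ) - m) / 2) * (((L : ℝ) + m) / 2 + 1) := by ring
  rw [hp, map_smul, hm', add_sub_cancel_right, smul_smul]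
  push_cast
  rw [hr, neg_mul_neg, ← Complex.ofReal_mul, Real.mul_self_sqrt hnn]
  push_cast
  rfl

theorem IsSpinModule.raise_neg_one (h : IsSpinModule L ψ T₀ Tp Tm) :
    Tp (ψ (-1)) = (-((L + 1) / 2) : ℂ) • ψ 1 := by
  have hr : (((L : ℝ) - (-1 : ℤ)) / 2) * (((L : ℝ) + (-1 : ℤ)) / 2 + 1) =
      (((L : ℝ) + 1) / 2) ^ 2 := by push_cast; ring
  rw [h.2.2.1, hr, Real.sqrt_sq (by positivity)]
  push_cast
  rfl

theorem IsSpinModule.lower_one (h : IsSpinModule L ψ T₀ Tp Tm) :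
    Tm (ψ 1) = (-((L + 1) / 2) : ℂ) • ψ (-1) := by
  have hr : (((L : ℝ) + (1 : ℤ)) / 2) * (((L : ℝ) - (1 : ℤ)) / 2 + 1) =
      (((L : ℝ) + 1) / 2) ^ 2 := by push_cast; ring
  rw [h.2.2.2, hr, Real.sqrt_sq (by positivity)]
  push_cast
  rfl

end SpinModule

variable {U V : Type} [AddCommGroup U] [Module ℂ U] [AddCommGroup V] [Module ℂ V]
  {L M : ℕ} {ψ : ℤ → U} {φ : ℤ → V} {T₀ Tp Tm : U →ₗ[ℂ] U} {W₀ Wp Wm : V →ₗ[ℂ] V}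

@[simp]
theorem opT_tmul (T : U →ₗ[ℂ] U) (u : U) (v : V) : opT T (u ⊗ₜ[ℂ] v) = T u ⊗ₜ[ℂ] v := rfl

@[simp]
theorem opW_tmul (W : V →ₗ[ℂ] V) (u : U) (v : V) : opW W (u ⊗ₜ[ℂ] v) = u ⊗ₜ[ℂ] W v := rfl

theorem Dzero_tmul (hU : IsSpinModule L ψ T₀ Tp Tm) (hV : IsSpinModule M φ W₀ Wp Wm) (m n : ℤ) :
    Dzero T₀ W₀ (ψ m ⊗ₜ[ℂ] φ n) = (Complex.I * ((m - n) / 2)) • (ψ m ⊗ₜ[ℂ] φ n) := by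
  simp only [Dzero, LinearMap.smul_apply, LinearMap.sub_apply, opT_tmul, opW_tmul, hU.2.1,
    hV.2.1, ← TensorProduct.smul_tmul', TensorProduct.tmul_smul]
  module

theorem Dquad_tmul (hU : IsSpinModule L ψ T₀ Tp Tm) (hV : IsSpinModule M φ W₀ Wp Wm) {m n : ℤ}
    (hm : |m| ≤ L) (hn : |n| ≤ M) :
    Dquad Tp Tm Wp Wm (ψ m ⊗ₜ[ℂ] φ n) =
      ((L * (L + 2) - m ^ 2 + M * (M + 2) - n ^ 2) / 2 : ℂ) • (ψ m ⊗ₜ[ℂ] φ n) := by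
  simp only [Dquad, LinearMap.add_apply, LinearMap.comp_apply, opT_tmul, opW_tmul,
    hU.raise_lower hm, hU.lower_raise hm, hV.raise_lower hn, hV.lower_raise hn,
    ← TensorProduct.smul_tmul', TensorProduct.tmul_smul]
  module

theorem raise_lower_tmul (hU : IsSpinModule L ψ T₀ Tp Tm) (hV : IsSpinModule M φ W₀ Wp Wm) :
    Tp (ψ (-1)) ⊗ₜ[ℂ] Wm (φ 1) = ((L + 1) / 2 * ((M + 1) / 2) : ℂ) • (ψ 1 ⊗ₜ[ℂ] φ (-1)) := by
  rw [hU.raise_neg_one, hV.lower_one, TensorProduct.smul_tmul_smul, neg_mul_neg]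

theorem lower_raise_tmul (hU : IsSpinModule L ψ T₀ Tp Tm) (hV : IsSpinModule M φ W₀ Wp Wm) :
    Tm (ψ 1) ⊗ₜ[ℂ] Wp (φ (-1)) = ((L + 1) / 2 * ((M + 1) / 2) : ℂ) • (ψ (-1) ⊗ₜ[ℂ] φ 1) := by
  rw [hU.lower_one, hV.raise_neg_one, TensorProduct.smul_tmul_smul, neg_mul_neg]

/-- The highest weight vector of the spin-`1/2` module is annihilated by the raising operator. -/
theorem IsSpinModule.raise_one (hU : IsSpinModule 1 ψ T₀ Tp Tm) : Tp (ψ 1) = 0 := by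
  simp [hU.2.2.1]

/-- The lowest weight vector of the spin-`1/2` module is annihilated by the lowering operator. -/
theorem IsSpinModule.lower_neg_one (hU : IsSpinModule 1 ψ T₀ Tp Tm) : Tm (ψ (-1)) = 0 := by
  simp [hU.2.2.2]

end Spin

/- STATEMENT 11: For ℓ₁ = 1/2 (doubled spin 1) and ℓ₂ = k + 1/2 a half-odd-integer
(doubled spin 2k+1), the vector v = χ_{1/2} + χ_{-1/2} = ψ 1 ⊗ φ (-1) + ψ (-1) ⊗ φ 1
satisfies D₀²v = -v, D₁v = -(ℓ₂² + 2ℓ₂ + 3/4)·v, D₂v = -(ℓ₂² - 1/4)·v and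
D₃v = -i(ℓ₂ + 1/2)·(χ_{1/2} - χ_{-1/2}). -/

open Spin in
theorem stmt11 {U V : Type} [AddCommGroup U] [Module ℂ U] [AddCommGroup V] [Module ℂ V]
    (k : ℕ) (ψ : ℤ → U) (φ : ℤ → V)
    (T₀ Tp Tm : U →ₗ[ℂ] U) (W₀ Wp Wm : V →ₗ[ℂ] V)
    (hU : IsSpinModule 1 ψ T₀ Tp Tm) (hV : IsSpinModule (2 * k + 1) φ W₀ Wp Wm) :
    Dzero T₀ W₀ (Dzero T₀ W₀ (ψ 1 ⊗ₜ[ℂ] φ (-1) + ψ (-1) ⊗ₜ[ℂ] φ 1))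
      = -(ψ 1 ⊗ₜ[ℂ] φ (-1) + ψ (-1) ⊗ₜ[ℂ] φ 1) ∧
    Done Tp Tm Wp Wm (ψ 1 ⊗ₜ[ℂ] φ (-1) + ψ (-1) ⊗ₜ[ℂ] φ 1)
      = (-(((2 * (k : ℂ) + 1) / 2) ^ 2 + 2 * ((2 * (k : ℂ) + 1) / 2) + 3 / 4)) •
          (ψ 1 ⊗ₜ[ℂ] φ (-1) + ψ (-1) ⊗ₜ[ℂ] φ 1) ∧
    Dtwo Tp Tm Wp Wm (ψ 1 ⊗ₜ[ℂ] φ (-1) + ψ (-1) ⊗ₜ[ℂ] φ 1)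
      = (-(((2 * (k : ℂ) + 1) / 2) ^ 2 - 1 / 4)) •
          (ψ 1 ⊗ₜ[ℂ] φ (-1) + ψ (-1) ⊗ₜ[ℂ] φ 1) ∧
    Dthree Tp Tm Wp Wm (ψ 1 ⊗ₜ[ℂ] φ (-1) + ψ (-1) ⊗ₜ[ℂ] φ 1)
      = (-(Complex.I * ((2 * (k : ℂ) + 1) / 2 + 1 / 2))) •
          (ψ 1 ⊗ₜ[ℂ] φ (-1) - ψ (-1) ⊗ₜ[ℂ] φ 1) := by
  have hTW := raise_lower_tmul hU hV
  have hWT := lower_raise_tmul hU hV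
  have hM : |(1 : ℤ)| ≤ (2 * k + 1 : ℕ) := by rw [abs_one]; omega
  have hM' : |(-1 : ℤ)| ≤ (2 * k + 1 : ℕ) := by rwa [abs_neg]
  have hQ := Dquad_tmul hU hV (m := 1) (n := -1) (by simp) hM'
  have hQ' := Dquad_tmul hU hV (m := -1) (n := 1) (by simp) hM
  push_cast at hTW hWT hQ hQ'
  refine ⟨?_, ?_, ?_, ?_⟩
  · simp only [map_add, map_smul, Dzero_tmul hU hV, smul_smul]
    push_cast
    ring_nf
    simp [add_comm]
  · simp only [Done, Across, map_add, LinearMap.sub_apply, LinearMap.add_apply,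
      LinearMap.smul_apply, LinearMap.comp_apply, opT_tmul, opW_tmul, hTW, hWT, hQ, hQ',
      hU.raise_one, hU.lower_neg_one, TensorProduct.zero_tmul]
    module
  · simp only [Dtwo, Across, map_add, LinearMap.add_apply,
      LinearMap.smul_apply, LinearMap.comp_apply, opT_tmul, opW_tmul, hTW, hWT, hQ, hQ',
      hU.raise_one, hU.lower_neg_one, TensorProduct.zero_tmul]
    module
  · simp only [Dthree, map_add, LinearMap.sub_apply,
      LinearMap.smul_apply, LinearMap.comp_apply, opT_tmul, opW_tmul, hTW, hWT,
      hU.raise_one, hU.lower_neg_one, TensorProduct.zero_tmul]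
    module
end
end

section
/- With the notation of the context, let ℓ₁ = 1/2 and let ℓ₂ be a half-odd-integer (ℓ₂ ∈ {1/2, 3/2, 5/2, …}). Then the vector w := χ_{1/2} − χ_{−1/2} satisfies D₀²w = −w, D₁w = −(ℓ₂² − 1/4)·w, D₂w = −(ℓ₂² + 2ℓ₂ + 3/4)·w, and D₃w = i(ℓ₂ + 1/2)·(χ_{1/2} + χ_{−1/2}). -/
open TensorProduct

noncomputable section

namespace Spin.IsSpinModule

variable {U : Type} [AddCommGroup U] [Module ℂ U] {L : ℕ} {ψ : ℤ → U} {T₀ Tp Tm : U →ₗ[ℂ] U}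

theorem lower_raise_s13 (h : IsSpinModule L ψ T₀ Tp Tm) {m : ℤ} (hm : |m| ≤ L) :
    Tm (Tp (ψ m)) = ((((L : ℂ) - m) / 2) * (((L : ℂ) + m) / 2 + 1)) • ψ m := by
  obtain ⟨-, -, hp, hl⟩ := h
  obtain ⟨h₁, h₂⟩ := abs_le.mp hm
  have h₁' : -(L : ℝ) ≤ m := by exact_mod_cast h₁
  have h₂' : (m : ℝ) ≤ L := by exact_mod_cast h₂
  have hnn : 0 ≤ (((L : ℝ) - m) / 2) * (((L : ℝ) + m) / 2 + 1) :=
    mul_nonneg (by linarith) (by linarith)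
  rw [hp, map_smul, hl, smul_smul, ← Complex.ofReal_mul, add_sub_cancel_right]
  have heq : (((L : ℝ) + ((m + 2 : ℤ) : ℝ)) / 2) * (((L : ℝ) - ((m + 2 : ℤ) : ℝ)) / 2 + 1)
      = (((L : ℝ) - m) / 2) * (((L : ℝ) + m) / 2 + 1) := by
    push_cast; ring
  rw [heq, neg_mul_neg, Real.mul_self_sqrt hnn]
  push_cast
  rfl

theorem raise_lower_s13 (h : IsSpinModule L ψ T₀ Tp Tm) {m : ℤ} (hm : |m| ≤ L) :
    Tp (Tm (ψ m)) = ((((L : ℂ) + m) / 2) * (((L : ℂ) - m) / 2 + 1)) • ψ m := by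
  obtain ⟨-, -, hp, hl⟩ := h
  obtain ⟨h₁, h₂⟩ := abs_le.mp hm
  have h₁' : -(L : ℝ) ≤ m := by exact_mod_cast h₁
  have h₂' : (m : ℝ) ≤ L := by exact_mod_cast h₂
  have hnn : 0 ≤ (((L : ℝ) + m) / 2) * (((L : ℝ) - m) / 2 + 1) :=
    mul_nonneg (by linarith) (by linarith)
  rw [hl, map_smul, hp, smul_smul, ← Complex.ofReal_mul, sub_add_cancel]
  have heq : (((L : ℝ) - ((m - 2 : ℤ) : ℝ)) / 2) * (((L : ℝ) + ((m - 2 : ℤ) : ℝ)) / 2 + 1)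
      = (((L : ℝ) + m) / 2) * (((L : ℝ) - m) / 2 + 1) := by
    push_cast; ring
  rw [heq, neg_mul_neg, Real.mul_self_sqrt hnn]
  push_cast
  rfl

theorem raise_neg_one_s13 (h : IsSpinModule L ψ T₀ Tp Tm) :
    Tp (ψ (-1)) = (-(((L : ℂ) + 1) / 2)) • ψ 1 := by
  have heq : (((L : ℝ) - ((-1 : ℤ) : ℝ)) / 2) * (((L : ℝ) + ((-1 : ℤ) : ℝ)) / 2 + 1)
      = (((L : ℝ) + 1) / 2) ^ 2 := by
    push_cast; ring
  rw [h.2.2.1, heq, Real.sqrt_sq (by positivity)]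
  push_cast
  rfl

theorem lower_one_s13 (h : IsSpinModule L ψ T₀ Tp Tm) :
    Tm (ψ 1) = (-(((L : ℂ) + 1) / 2)) • ψ (-1) := by
  have heq : (((L : ℝ) + ((1 : ℤ) : ℝ)) / 2) * (((L : ℝ) - ((1 : ℤ) : ℝ)) / 2 + 1)
      = (((L : ℝ) + 1) / 2) ^ 2 := by
    push_cast; ring
  rw [h.2.2.2, heq, Real.sqrt_sq (by positivity)]
  push_cast
  rfl

/-- In the spin-`1/2` module, `ψ_{1/2}` is a highest weight vector. -/
theorem raise_one_s13 (h : IsSpinModule 1 ψ T₀ Tp Tm) : Tp (ψ 1) = 0 := by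
  rw [h.2.2.1, h.1 (1 + 2) (by norm_num), smul_zero]

/-- In the spin-`1/2` module, `ψ_{-1/2}` is a lowest weight vector. -/
theorem lower_neg_one_s13 (h : IsSpinModule 1 ψ T₀ Tp Tm) : Tm (ψ (-1)) = 0 := by
  rw [h.2.2.2, h.1 (-1 - 2) (by norm_num), smul_zero]

end Spin.IsSpinModule

/- STATEMENT 13: For ℓ₁ = 1/2 (doubled spin 1) and ℓ₂ = k + 1/2 a half-odd-integer
(doubled spin 2k+1), the vector w = χ_{1/2} - χ_{-1/2} = ψ 1 ⊗ φ (-1) - ψ (-1) ⊗ φ 1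
satisfies D₀²w = -w, D₁w = -(ℓ₂² - 1/4)·w, D₂w = -(ℓ₂² + 2ℓ₂ + 3/4)·w and
D₃w = i(ℓ₂ + 1/2)·(χ_{1/2} + χ_{-1/2}). -/

open Spin in
theorem stmt13 {U V : Type} [AddCommGroup U] [Module ℂ U] [AddCommGroup V] [Module ℂ V]
    (k : ℕ) (ψ : ℤ → U) (φ : ℤ → V)
    (T₀ Tp Tm : U →ₗ[ℂ] U) (W₀ Wp Wm : V →ₗ[ℂ] V)
    (hU : IsSpinModule 1 ψ T₀ Tp Tm) (hV : IsSpinModule (2 * k + 1) φ W₀ Wp Wm) :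
    Dzero T₀ W₀ (Dzero T₀ W₀ (ψ 1 ⊗ₜ[ℂ] φ (-1) - ψ (-1) ⊗ₜ[ℂ] φ 1))
      = -(ψ 1 ⊗ₜ[ℂ] φ (-1) - ψ (-1) ⊗ₜ[ℂ] φ 1) ∧
    Done Tp Tm Wp Wm (ψ 1 ⊗ₜ[ℂ] φ (-1) - ψ (-1) ⊗ₜ[ℂ] φ 1)
      = (-(((2 * (k : ℂ) + 1) / 2) ^ 2 - 1 / 4)) •
          (ψ 1 ⊗ₜ[ℂ] φ (-1) - ψ (-1) ⊗ₜ[ℂ] φ 1) ∧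
    Dtwo Tp Tm Wp Wm (ψ 1 ⊗ₜ[ℂ] φ (-1) - ψ (-1) ⊗ₜ[ℂ] φ 1)
      = (-(((2 * (k : ℂ) + 1) / 2) ^ 2 + 2 * ((2 * (k : ℂ) + 1) / 2) + 3 / 4)) •
          (ψ 1 ⊗ₜ[ℂ] φ (-1) - ψ (-1) ⊗ₜ[ℂ] φ 1) ∧
    Dthree Tp Tm Wp Wm (ψ 1 ⊗ₜ[ℂ] φ (-1) - ψ (-1) ⊗ₜ[ℂ] φ 1)
      = (Complex.I * ((2 * (k : ℂ) + 1) / 2 + 1 / 2)) •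
          (ψ 1 ⊗ₜ[ℂ] φ (-1) + ψ (-1) ⊗ₜ[ℂ] φ 1) := by
  have hL : |(1 : ℤ)| ≤ ((2 * k + 1 : ℕ) : ℤ) := by simp
  have hL' : |(-1 : ℤ)| ≤ ((2 * k + 1 : ℕ) : ℤ) := by simp
  refine ⟨?_, ?_, ?_, ?_⟩
  · simp only [Dzero, opT, opW, LinearMap.smul_apply, LinearMap.sub_apply, map_sub, map_smul,
      LinearMap.rTensor_tmul, LinearMap.lTensor_tmul, hU.2.1, hV.2.1,
      TensorProduct.tmul_smul, ← TensorProduct.smul_tmul']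
    match_scalars <;> ring_nf <;> simp
  all_goals
    simp only [Done, Dtwo, Dthree, Dquad, Across, opT, opW, LinearMap.smul_apply,
      LinearMap.sub_apply, LinearMap.add_apply, LinearMap.comp_apply, map_sub, map_smul,
      LinearMap.rTensor_tmul, LinearMap.lTensor_tmul, hU.raise_one_s13, hU.lower_neg_one_s13,
      hU.raise_neg_one_s13, hU.lower_one_s13, hV.raise_neg_one_s13, hV.lower_one_s13,
      hV.lower_raise_s13 hL, hV.raise_lower_s13 hL',
      TensorProduct.tmul_smul, ← TensorProduct.smul_tmul', TensorProduct.zero_tmul, map_zero]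
    match_scalars <;> ring
end
end

section
/- With the notation of the context, let ℓ₂ = 1 and let ℓ₁ be a positive integer. Then the vector w := χ₁ − χ₋₁ satisfies D₀²w = −4w, D₁w = D₂w = −ℓ₁(ℓ₁+1)·w, and D₃w = 2√(2ℓ₁(ℓ₁+1))·i·χ₀. -/
open TensorProduct

noncomputable section

/- STATEMENT 16: For ℓ₂ = 1 (doubled spin 2) and ℓ₁ a positive integer (doubled spin
2ℓ₁), the vector w = χ₁ - χ₋₁ = ψ 2 ⊗ φ (-2) - ψ (-2) ⊗ φ 2 satisfies D₀²w = -4w,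
D₁w = D₂w = -ℓ₁(ℓ₁+1)·w and D₃w = 2√(2ℓ₁(ℓ₁+1))·i·χ₀. -/

open Spin in
theorem stmt16 {U V : Type} [AddCommGroup U] [Module ℂ U] [AddCommGroup V] [Module ℂ V]
    (ℓ₁ : ℕ) (hℓ₁ : 1 ≤ ℓ₁) (ψ : ℤ → U) (φ : ℤ → V)
    (T₀ Tp Tm : U →ₗ[ℂ] U) (W₀ Wp Wm : V →ₗ[ℂ] V)
    (hU : IsSpinModule (2 * ℓ₁) ψ T₀ Tp Tm) (hV : IsSpinModule 2 φ W₀ Wp Wm) :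
    Dzero T₀ W₀ (Dzero T₀ W₀ (ψ 2 ⊗ₜ[ℂ] φ (-2) - ψ (-2) ⊗ₜ[ℂ] φ 2))
      = (-4 : ℂ) • (ψ 2 ⊗ₜ[ℂ] φ (-2) - ψ (-2) ⊗ₜ[ℂ] φ 2) ∧
    Done Tp Tm Wp Wm (ψ 2 ⊗ₜ[ℂ] φ (-2) - ψ (-2) ⊗ₜ[ℂ] φ 2)
      = (-((ℓ₁ : ℂ) * ((ℓ₁ : ℂ) + 1))) • (ψ 2 ⊗ₜ[ℂ] φ (-2) - ψ (-2) ⊗ₜ[ℂ] φ 2) ∧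
    Dtwo Tp Tm Wp Wm (ψ 2 ⊗ₜ[ℂ] φ (-2) - ψ (-2) ⊗ₜ[ℂ] φ 2)
      = (-((ℓ₁ : ℂ) * ((ℓ₁ : ℂ) + 1))) • (ψ 2 ⊗ₜ[ℂ] φ (-2) - ψ (-2) ⊗ₜ[ℂ] φ 2) ∧
    Dthree Tp Tm Wp Wm (ψ 2 ⊗ₜ[ℂ] φ (-2) - ψ (-2) ⊗ₜ[ℂ] φ 2)
      = (((2 * Real.sqrt (2 * (ℓ₁ : ℝ) * ((ℓ₁ : ℝ) + 1)) : ℝ) : ℂ) * Complex.I) •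
          (ψ 0 ⊗ₜ[ℂ] φ 0) := by
  obtain ⟨-, hT0, hTp, hTm⟩ := hU
  obtain ⟨-, hW0, hWp, hWm⟩ := hV
  have h1 : (1 : ℝ) ≤ ℓ₁ := by exact_mod_cast hℓ₁
  obtain ⟨a, ha⟩ : ∃ a : ℂ, a = (Real.sqrt ((ℓ₁ : ℝ) * (ℓ₁ + 1)) : ℝ) := ⟨_, rfl⟩
  obtain ⟨b, hb⟩ : ∃ b : ℂ, b = (Real.sqrt (((ℓ₁ : ℝ) - 1) * (ℓ₁ + 2)) : ℝ) := ⟨_, rfl⟩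
  obtain ⟨c, hc⟩ : ∃ c : ℂ, c = (Real.sqrt 2 : ℝ) := ⟨_, rfl⟩
  have ha2 : a * a = ℓ₁ * (ℓ₁ + 1) := by
    rw [ha, ← Complex.ofReal_mul, Real.mul_self_sqrt (by positivity)]
    push_cast; ring
  have hb2 : b * b = (ℓ₁ - 1) * (ℓ₁ + 2) := by
    rw [hb, ← Complex.ofReal_mul,
      Real.mul_self_sqrt (mul_nonneg (by linarith) (by linarith))]
    push_cast; ring
  have hc2 : c * c = 2 := by
    rw [hc, ← Complex.ofReal_mul, Real.mul_self_sqrt (by positivity)]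
    norm_num
  have hac : ((Real.sqrt (2 * (ℓ₁ : ℝ) * ((ℓ₁ : ℝ) + 1)) : ℝ) : ℂ) = a * c := by
    rw [ha, hc, ← Complex.ofReal_mul, ← Real.sqrt_mul (by positivity)]
    congr 2; ring
  have coeff {x y : ℝ} {z : ℂ} (hz : z = (Real.sqrt y : ℝ)) (hxy : x = y) :
      ((-Real.sqrt x : ℝ) : ℂ) = -z := by
    rw [hz, hxy, Complex.ofReal_neg]
  have hTp2 : Tp (ψ 2) = (-b) • ψ 4 := by
    rw [hTp, coeff hb (by push_cast; ring)]; norm_num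
  have hTm4 : Tm (ψ 4) = (-b) • ψ 2 := by
    rw [hTm, coeff hb (by push_cast; ring)]; norm_num
  have hTm2 : Tm (ψ 2) = (-a) • ψ 0 := by
    rw [hTm, coeff ha (by push_cast; ring)]; norm_num
  have hTp0 : Tp (ψ 0) = (-a) • ψ 2 := by
    rw [hTp, coeff ha (by push_cast; ring)]; norm_num
  have hTm0 : Tm (ψ 0) = (-a) • ψ (-2) := by
    rw [hTm, coeff ha (by push_cast; ring)]; norm_num
  have hTpn2 : Tp (ψ (-2)) = (-a) • ψ 0 := by
    rw [hTp, coeff ha (by push_cast; ring)]; norm_num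
  have hTmn2 : Tm (ψ (-2)) = (-b) • ψ (-4) := by
    rw [hTm, coeff hb (by push_cast; ring)]; norm_num
  have hTpn4 : Tp (ψ (-4)) = (-b) • ψ (-2) := by
    rw [hTp, coeff hb (by push_cast; ring)]; norm_num
  have hWp2 : Wp (φ 2) = 0 := by rw [hWp]; norm_num
  have hWmn2 : Wm (φ (-2)) = 0 := by rw [hWm]; norm_num
  have hWm2 : Wm (φ 2) = (-c) • φ 0 := by
    rw [hWm, coeff hc (by norm_num)]; norm_num
  have hWp0 : Wp (φ 0) = (-c) • φ 2 := by
    rw [hWp, coeff hc (by norm_num)]; norm_num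
  have hWm0 : Wm (φ 0) = (-c) • φ (-2) := by
    rw [hWm, coeff hc (by norm_num)]; norm_num
  have hWpn2 : Wp (φ (-2)) = (-c) • φ 0 := by
    rw [hWp, coeff hc (by norm_num)]; norm_num
  rw [Complex.ofReal_mul, hac]
  refine ⟨?_, ?_, ?_, ?_⟩
  · simp only [Dzero, opT, opW, LinearMap.smul_apply, LinearMap.sub_apply, map_sub, map_smul,
      LinearMap.rTensor_tmul, LinearMap.lTensor_tmul, hT0, hW0, ← TensorProduct.smul_tmul',
      TensorProduct.tmul_smul]
    push_cast
    match_scalars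
    · linear_combination 4 * Complex.I_mul_I
    · linear_combination (-4) * Complex.I_mul_I
  all_goals
    simp only [Done, Dtwo, Dthree, Dquad, Across, opT, opW, LinearMap.smul_apply,
      LinearMap.sub_apply, LinearMap.add_apply, LinearMap.comp_apply, map_sub, map_smul, map_zero,
      LinearMap.rTensor_tmul, LinearMap.lTensor_tmul, ← TensorProduct.smul_tmul',
      TensorProduct.tmul_smul, TensorProduct.tmul_zero,
      hTp2, hTm4, hTm2, hTp0, hTm0, hTpn2, hTmn2, hTpn4, hWp2, hWmn2, hWm2, hWp0, hWm0, hWpn2]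
  · match_scalars
    · linear_combination (-1 / 2 : ℂ) * (ha2 + hb2 + hc2)
    · ring
    · linear_combination (1 / 2 : ℂ) * (ha2 + hb2 + hc2)
  · match_scalars
    · linear_combination (-1 / 2 : ℂ) * (ha2 + hb2 + hc2)
    · ring
    · linear_combination (1 / 2 : ℂ) * (ha2 + hb2 + hc2)
  · match_scalars
    ring
end
end

section
/- With the Poisson bracket and the functions 𝒫₀ = p₄, 𝒫₁ = p₅² + p₆², 𝒫₂ = p₂² + p₃², 𝒫₃ = −p₃p₅ + p₂p₆ defined in the context, the identities [𝒫₀,𝒫₁]_P = −2𝒫₃, [𝒫₀,𝒫₂]_P = 2𝒫₃ and [𝒫₀,𝒫₃]_P = 𝒫₁ − 𝒫₂ hold at every point of ℝ⁶, and at every point (p₁,…,p₆) ∈ ℝ⁶ with p₁ = 0 the identities [𝒫₁,𝒫₂]_P = −4𝒫₀𝒫₃, [𝒫₁,𝒫₃]_P = −2𝒫₀𝒫₁ and [𝒫₂,𝒫₃]_P = 2𝒫₀𝒫₂ hold (all sides evaluated at that point). -/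
/- STATEMENT 18: Lie–Poisson brackets of the SO(4)-invariant functions
𝒫₀ = p₄, 𝒫₁ = p₅² + p₆², 𝒫₂ = p₂² + p₃², 𝒫₃ = -p₃p₅ + p₂p₆ on so(4)* ≅ ℝ⁶,
with basis L₁, L₂, L₃, Y₁, Y₂, Y₃ (coordinates p₁,…,p₆; indices 0,…,5 in Lean). -/

noncomputable section

open Finset

namespace Stmt18

/-- The totally antisymmetric symbol on {0,1,2} with ε₀₁₂ = 1
(valid for arguments in {0,1,2}). -/
def eps3 (a b c : ℕ) : ℝ :=
  ((b : ℝ) - (a : ℝ)) * ((c : ℝ) - (b : ℝ)) * ((c : ℝ) - (a : ℝ)) / 2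

/-- Structure constants of so(4) in the basis e₀ = L₁, e₁ = L₂, e₂ = L₃,
e₃ = Y₁, e₄ = Y₂, e₅ = Y₃: `[e i, e j] = Σ k, c6 i j k • e k`, where
[L_i, L_j] = Σ ε_{ijk} L_k, [Y_i, Y_j] = Σ ε_{ijk} L_k, [L_i, Y_j] = Σ ε_{ijk} Y_k. -/
def c6 (i j k : Fin 6) : ℝ :=
  if i.val < 3 then
    (if j.val < 3 then
      (if k.val < 3 then eps3 i.val j.val k.val else 0)
     else
      (if 3 ≤ k.val then eps3 i.val (j.val - 3) (k.val - 3) else 0))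
  else
    (if j.val < 3 then
      (if 3 ≤ k.val then eps3 (i.val - 3) j.val (k.val - 3) else 0)
     else
      (if k.val < 3 then eps3 (i.val - 3) (j.val - 3) k.val else 0))

/-- The Lie–Poisson bracket [f,g]_P(x) = Σ_{i,j,k} c^k_{ij} x_k ∂f/∂x_i ∂g/∂x_j. -/
def PB (f g : (Fin 6 → ℝ) → ℝ) (x : Fin 6 → ℝ) : ℝ :=
  ∑ i : Fin 6, ∑ j : Fin 6, ∑ k : Fin 6,
    c6 i j k * x k * fderiv ℝ f x (Pi.single i 1) * fderiv ℝ g x (Pi.single j 1)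

/-- 𝒫₀ = p₄. -/
def P0 (x : Fin 6 → ℝ) : ℝ := x 3
/-- 𝒫₁ = p₅² + p₆². -/
def P1 (x : Fin 6 → ℝ) : ℝ := (x 4) ^ 2 + (x 5) ^ 2
/-- 𝒫₂ = p₂² + p₃². -/
def P2 (x : Fin 6 → ℝ) : ℝ := (x 1) ^ 2 + (x 2) ^ 2
/-- 𝒫₃ = -p₃p₅ + p₂p₆. -/
def P3 (x : Fin 6 → ℝ) : ℝ := -(x 2) * (x 4) + (x 1) * (x 5)

theorem fderiv_P0_apply (x v : Fin 6 → ℝ) : fderiv ℝ P0 x v = v 3 := by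
  have h : HasFDerivAt P0 _ x := hasFDerivAt_apply (𝕜 := ℝ) 3 x
  simp [h.fderiv]

theorem fderiv_P1_apply (x v : Fin 6 → ℝ) :
    fderiv ℝ P1 x v = 2 * x 4 * v 4 + 2 * x 5 * v 5 := by
  have h : HasFDerivAt P1 _ x :=
    ((hasFDerivAt_apply (𝕜 := ℝ) 4 x).pow 2).add ((hasFDerivAt_apply (𝕜 := ℝ) 5 x).pow 2)
  simp [h.fderiv]

theorem fderiv_P2_apply (x v : Fin 6 → ℝ) :
    fderiv ℝ P2 x v = 2 * x 1 * v 1 + 2 * x 2 * v 2 := by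
  have h : HasFDerivAt P2 _ x :=
    ((hasFDerivAt_apply (𝕜 := ℝ) 1 x).pow 2).add ((hasFDerivAt_apply (𝕜 := ℝ) 2 x).pow 2)
  simp [h.fderiv]

theorem fderiv_P3_apply (x v : Fin 6 → ℝ) :
    fderiv ℝ P3 x v = -(x 2 * v 4 + x 4 * v 2) + (x 1 * v 5 + x 5 * v 1) := by
  have h : HasFDerivAt P3 _ x :=
    ((hasFDerivAt_apply (𝕜 := ℝ) 2 x).neg.mul (hasFDerivAt_apply (𝕜 := ℝ) 4 x)).add
      ((hasFDerivAt_apply (𝕜 := ℝ) 1 x).mul (hasFDerivAt_apply (𝕜 := ℝ) 5 x))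
  simp [h.fderiv]
  ring

/-- The Lie–Poisson bracket in terms of the differentials of `f` and `g`, each pair of basis
vectors of so(4) with nonzero bracket appearing once. -/
theorem PB_eq (f g : (Fin 6 → ℝ) → ℝ) (x : Fin 6 → ℝ) :
    PB f g x =
      let a i := fderiv ℝ f x (Pi.single i 1)
      let b i := fderiv ℝ g x (Pi.single i 1)
      x 0 * (a 1 * b 2 - a 2 * b 1 + a 4 * b 5 - a 5 * b 4) +
      x 1 * (a 2 * b 0 - a 0 * b 2 + a 5 * b 3 - a 3 * b 5) +
      x 2 * (a 0 * b 1 - a 1 * b 0 + a 3 * b 4 - a 4 * b 3) +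
      x 3 * (a 1 * b 5 - a 2 * b 4 + a 4 * b 2 - a 5 * b 1) +
      x 4 * (a 2 * b 3 - a 0 * b 5 + a 5 * b 0 - a 3 * b 2) +
      x 5 * (a 0 * b 4 - a 1 * b 3 + a 3 * b 1 - a 4 * b 0) := by
  simp only [PB, c6, eps3, Fin.sum_univ_six]
  norm_num
  ring

theorem poisson_brackets_so4 :
    (∀ x : Fin 6 → ℝ,
      PB P0 P1 x = -2 * P3 x ∧
      PB P0 P2 x = 2 * P3 x ∧
      PB P0 P3 x = P1 x - P2 x) ∧
    (∀ x : Fin 6 → ℝ, x 0 = 0 →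
      PB P1 P2 x = -4 * (P0 x * P3 x) ∧
      PB P1 P3 x = -2 * (P0 x * P1 x) ∧
      PB P2 P3 x = 2 * (P0 x * P2 x)) := by
  refine ⟨fun x => ⟨?_, ?_, ?_⟩, fun x hx => ⟨?_, ?_, ?_⟩⟩ <;>
    simp [PB_eq, fderiv_P0_apply, fderiv_P1_apply, fderiv_P2_apply, fderiv_P3_apply,
      P0, P1, P2, P3, *] <;>
    ring

end Stmt18
end
end

section
/- Let μ, ν, p₄, ψ, χ, u, v be real numbers with u² − v² = μ + p₄² and uv = ν. Define p₂ := u·coshψ·cosχ + v·sinhψ·sinχ, p₃ := v·sinhψ·cosχ − u·coshψ·sinχ, p₅ := v·coshψ·cosχ − u·sinhψ·sinχ, p₆ := −u·sinhψ·cosχ − v·coshψ·sinχ. Then: p₂² + p₃² = (1/2)(μ + p₄² + √((μ + p₄²)² + 4ν²)·cosh 2ψ); p₅² + p₆² = (1/2)(−μ − p₄² + √((μ + p₄²)² + 4ν²)·cosh 2ψ); and p₃p₅ − p₂p₆ = (1/2)√((μ + p₄²)² + 4ν²)·sinh 2ψ. -/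
/- STATEMENT 19: Identities for the coordinates (p₂, p₃, p₅, p₆) on the coadjoint
orbit of O₀(1,3) parametrized by (p₄, ψ, χ) with u² - v² = μ + p₄² and uv = ν. -/

theorem orbit_coordinate_identities (μ ν p₄ ψ χ u v : ℝ)
    (huv₁ : u ^ 2 - v ^ 2 = μ + p₄ ^ 2) (huv₂ : u * v = ν) :
    let p₂ := u * Real.cosh ψ * Real.cos χ + v * Real.sinh ψ * Real.sin χ
    let p₃ := v * Real.sinh ψ * Real.cos χ - u * Real.cosh ψ * Real.sin χ
    let p₅ := v * Real.cosh ψ * Real.cos χ - u * Real.sinh ψ * Real.sin χ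
    let p₆ := -u * Real.sinh ψ * Real.cos χ - v * Real.cosh ψ * Real.sin χ
    p₂ ^ 2 + p₃ ^ 2
        = (1 / 2) * (μ + p₄ ^ 2
            + Real.sqrt ((μ + p₄ ^ 2) ^ 2 + 4 * ν ^ 2) * Real.cosh (2 * ψ)) ∧
    p₅ ^ 2 + p₆ ^ 2
        = (1 / 2) * (-μ - p₄ ^ 2
            + Real.sqrt ((μ + p₄ ^ 2) ^ 2 + 4 * ν ^ 2) * Real.cosh (2 * ψ)) ∧
    p₃ * p₅ - p₂ * p₆
        = (1 / 2) * Real.sqrt ((μ + p₄ ^ 2) ^ 2 + 4 * ν ^ 2) * Real.sinh (2 * ψ) := by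
  have hsqrt : Real.sqrt ((μ + p₄ ^ 2) ^ 2 + 4 * ν ^ 2) = u ^ 2 + v ^ 2 := by
    rw [← huv₁, ← huv₂, show (u ^ 2 - v ^ 2) ^ 2 + 4 * (u * v) ^ 2 = (u ^ 2 + v ^ 2) ^ 2 by ring]
    exact Real.sqrt_sq (by positivity)
  have htrig := Real.cos_sq_add_sin_sq χ
  have hhyp := Real.cosh_sq_sub_sinh_sq ψ
  intro p₂ p₃ p₅ p₆
  simp only [p₂, p₃, p₅, p₆, hsqrt, Real.cosh_two_mul, Real.sinh_two_mul]
  refine ⟨?_, ?_, ?_⟩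
  · linear_combination (u ^ 2 * Real.cosh ψ ^ 2 + v ^ 2 * Real.sinh ψ ^ 2) * htrig
      + (1 / 2) * (u ^ 2 - v ^ 2) * hhyp + (1 / 2) * huv₁
  · linear_combination (v ^ 2 * Real.cosh ψ ^ 2 + u ^ 2 * Real.sinh ψ ^ 2) * htrig
      - (1 / 2) * (u ^ 2 - v ^ 2) * hhyp - (1 / 2) * huv₁
  · linear_combination (u ^ 2 + v ^ 2) * Real.cosh ψ * Real.sinh ψ * htrig
end
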